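/- If the quadruple of doubled-up matrices F ∈ ℂ^{2n×2n}, G ∈ ℂ^{2n×2m}, H ∈ ℂ^{2m×2n}, K ∈ ℂ^{2m×2m} is physically realizable, then the corresponding transfer function Γ(s) = H(sI − F)^{−1}G + K is dual (J,J)-unitary. -/

import Mathlib

open Matrix

noncomputable section

/-- `J_k = [[I, 0],[0, −I]]`. -/
def Jmat (k : ℕ) : Matrix (Fin k ⊕ Fin k) (Fin k ⊕ Fin k) ℂ :=
  Matrix.fromBlocks 1 0 0 (-1)

/-- `Σ_k = [[0, I],[I, 0]]`. -/
def SigmaMat (k : ℕ) : Matrix (Fin k ⊕ Fin k) (Fin k ⊕ Fin k) ℂ :=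
  Matrix.fromBlocks 0 1 1 0

/-- Entrywise complex conjugate of a matrix. -/
def conjMat {α β : Type*} (R : Matrix α β ℂ) : Matrix α β ℂ :=
  R.map (starRingEnd ℂ)

/-- `R ∈ ℂ^{2n×2m}` is doubled-up if `R Σ_m = Σ_n R^#`. -/
def DoubledUp {n m : ℕ} (R : Matrix (Fin n ⊕ Fin n) (Fin m ⊕ Fin m) ℂ) : Prop :=
  R * SigmaMat m = SigmaMat n * conjMat R

/-- Physical realizability of the QSDE matrices `(F, G, H, K)`: there exist an invertible
doubled-up `T`, a Hermitian doubled-up `M`, a doubled-up `N` and `S` with `S†S = I` such that,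
with `Θ := T J_n T†`: `F = −iΘM − (1/2)Θ N† J_m N`, `G = −Θ N† diag(S, −S^#)`, `H = N`,
`K = diag(S, S^#)`. -/
def PhysicallyRealizable {n m : ℕ}
    (F : Matrix (Fin n ⊕ Fin n) (Fin n ⊕ Fin n) ℂ)
    (G : Matrix (Fin n ⊕ Fin n) (Fin m ⊕ Fin m) ℂ)
    (H : Matrix (Fin m ⊕ Fin m) (Fin n ⊕ Fin n) ℂ)
    (K : Matrix (Fin m ⊕ Fin m) (Fin m ⊕ Fin m) ℂ) : Prop :=
  ∃ (T M : Matrix (Fin n ⊕ Fin n) (Fin n ⊕ Fin n) ℂ)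
    (N : Matrix (Fin m ⊕ Fin m) (Fin n ⊕ Fin n) ℂ)
    (S : Matrix (Fin m) (Fin m) ℂ),
      IsUnit T ∧ DoubledUp T ∧ Mᴴ = M ∧ DoubledUp M ∧ DoubledUp N ∧ Sᴴ * S = 1 ∧
      F = -(Complex.I • ((T * Jmat n * Tᴴ) * M)) -
            (1 / 2 : ℂ) • ((T * Jmat n * Tᴴ) * Nᴴ * Jmat m * N) ∧
      G = -((T * Jmat n * Tᴴ) * Nᴴ * Matrix.fromBlocks S 0 0 (-(conjMat S))) ∧
      H = N ∧
      K = Matrix.fromBlocks S 0 0 (conjMat S)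

/-- The transfer function `Γ(s) = H (sI − F)⁻¹ G + K`. -/
def transferFn {N M P : Type*} [Fintype N] [DecidableEq N]
    (F : Matrix N N ℂ) (G : Matrix N M ℂ) (H : Matrix P N ℂ) (K : Matrix P M ℂ)
    (s : ℂ) : Matrix P M ℂ :=
  H * (s • (1 : Matrix N N ℂ) - F)⁻¹ * G + K

/-- `Γ` is dual `(J,J)`-unitary: `Γ(s) J_m Γ(−s̄)† = J_m` for all `s` with `Re s ≥ 0`
such that both `sI − F` and `−s̄I − F` are invertible. -/
def DualJJUnitary {n m : ℕ}
    (F : Matrix (Fin n ⊕ Fin n) (Fin n ⊕ Fin n) ℂ)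
    (G : Matrix (Fin n ⊕ Fin n) (Fin m ⊕ Fin m) ℂ)
    (H : Matrix (Fin m ⊕ Fin m) (Fin n ⊕ Fin n) ℂ)
    (K : Matrix (Fin m ⊕ Fin m) (Fin m ⊕ Fin m) ℂ) : Prop :=
  ∀ s : ℂ, 0 ≤ s.re →
    IsUnit (s • (1 : Matrix (Fin n ⊕ Fin n) (Fin n ⊕ Fin n) ℂ) - F) →
    IsUnit ((-(starRingEnd ℂ s)) • (1 : Matrix (Fin n ⊕ Fin n) (Fin n ⊕ Fin n) ℂ) - F) →
    transferFn F G H K s * Jmat m * (transferFn F G H K (-(starRingEnd ℂ s)))ᴴ = Jmat m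

/-- A transfer function satisfying the fundamental identities of a lossless realization preserves
the indefinite form `J`. -/
theorem transferFn_mul_mul_conjTranspose {X Y : Type*} [Fintype X] [DecidableEq X] [Fintype Y]
    {F Θ : Matrix X X ℂ} {G : Matrix X Y ℂ} {N : Matrix Y X ℂ} {K J : Matrix Y Y ℂ}
    (hLyap : F * Θ + Θ * Fᴴ = -(Θ * Nᴴ * J * N * Θ))
    (hGG : G * J * Gᴴ = Θ * Nᴴ * J * N * Θ) (hGK : G * J * Kᴴ = -(Θ * Nᴴ))
    (hKG : K * J * Gᴴ = -(N * Θ)) (hKK : K * J * Kᴴ = J) {s : ℂ}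
    (hP : IsUnit (s • (1 : Matrix X X ℂ) - F))
    (hQ : IsUnit ((-(starRingEnd ℂ s)) • (1 : Matrix X X ℂ) - F)) :
    transferFn F G N K s * J * (transferFn F G N K (-(starRingEnd ℂ s)))ᴴ = J := by
  unfold transferFn
  have hsum : (s • (1 : Matrix X X ℂ) - F) * Θ +
      Θ * ((-(starRingEnd ℂ s)) • (1 : Matrix X X ℂ) - F)ᴴ = Θ * Nᴴ * J * N * Θ := by
    rw [← neg_eq_iff_eq_neg] at hLyap
    rw [← hLyap]
    simp [sub_mul, mul_sub, conjTranspose_smul]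
    abel
  set P := s • (1 : Matrix X X ℂ) - F
  set Q := (-(starRingEnd ℂ s)) • (1 : Matrix X X ℂ) - F
  have hA : P⁻¹ * P = 1 := nonsing_inv_mul P ((isUnit_iff_isUnit_det P).1 hP)
  have hB : Qᴴ * (Q⁻¹)ᴴ = 1 := by
    rw [← conjTranspose_mul, nonsing_inv_mul Q ((isUnit_iff_isUnit_det Q).1 hQ),
      conjTranspose_one]
  have key : P⁻¹ * (G * J * Gᴴ) * (Q⁻¹)ᴴ = Θ * (Q⁻¹)ᴴ + P⁻¹ * Θ := by
    rw [hGG, ← hsum, mul_add, add_mul, ← Matrix.mul_assoc P⁻¹ P, hA, Matrix.one_mul,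
      Matrix.mul_assoc P⁻¹, Matrix.mul_assoc Θ, hB, Matrix.mul_one]
  have expand : (N * P⁻¹ * G + K) * J * (N * Q⁻¹ * G + K)ᴴ =
      N * (P⁻¹ * (G * J * Gᴴ) * (Q⁻¹)ᴴ) * Nᴴ + N * P⁻¹ * (G * J * Kᴴ) +
        K * J * Gᴴ * (Q⁻¹)ᴴ * Nᴴ + K * J * Kᴴ := by
    simp only [conjTranspose_add, conjTranspose_mul, Matrix.add_mul, Matrix.mul_add,
      Matrix.mul_assoc]
    abel
  rw [expand, key, hGK, hKG, hKK]
  simp only [Matrix.add_mul, Matrix.mul_add, Matrix.mul_neg, Matrix.neg_mul, Matrix.mul_assoc]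
  abel

theorem conjTranspose_Jmat (k : ℕ) : (Jmat k)ᴴ = Jmat k := by
  simp [Jmat, fromBlocks_conjTranspose]

theorem Jmat_mul_Jmat (k : ℕ) : Jmat k * Jmat k = 1 := by
  simp [Jmat, fromBlocks_multiply]

theorem conjMat_mul_conjTranspose {m : ℕ} {S : Matrix (Fin m) (Fin m) ℂ} (hS : S * Sᴴ = 1) :
    conjMat S * (conjMat S)ᴴ = 1 := by
  have h := congrArg (fun R : Matrix (Fin m) (Fin m) ℂ => R.map (starRingEnd ℂ)) hS
  rw [Matrix.map_mul, Matrix.map_one _ (map_zero _) (map_one _)] at h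
  exact h

/-- if the doubled-up quadruple `(F,G,H,K)` is physically realizable, then its
transfer function is dual `(J,J)`-unitary. -/
theorem stmt5 (n m : ℕ) (hn : 0 < n) (hm : 0 < m)
    (F : Matrix (Fin n ⊕ Fin n) (Fin n ⊕ Fin n) ℂ)
    (G : Matrix (Fin n ⊕ Fin n) (Fin m ⊕ Fin m) ℂ)
    (H : Matrix (Fin m ⊕ Fin m) (Fin n ⊕ Fin n) ℂ)
    (K : Matrix (Fin m ⊕ Fin m) (Fin m ⊕ Fin m) ℂ)
    (hF : DoubledUp F) (hG : DoubledUp G) (hH : DoubledUp H) (hK : DoubledUp K)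
    (hreal : PhysicallyRealizable F G H K) :
    DualJJUnitary F G H K := by
  obtain ⟨T, M, N, S, -, -, hM, -, -, hS, rfl, rfl, rfl, rfl⟩ := hreal
  have hΘ : (T * Jmat n * Tᴴ)ᴴ = T * Jmat n * Tᴴ := by
    simp only [conjTranspose_mul, conjTranspose_conjTranspose, conjTranspose_Jmat,
      Matrix.mul_assoc]
  have hS' : S * Sᴴ = 1 := mul_eq_one_comm.1 hS
  have hKK : fromBlocks S 0 0 (conjMat S) * Jmat m * (fromBlocks S 0 0 (conjMat S))ᴴ = Jmat m := by
    simp [Jmat, fromBlocks_conjTranspose, fromBlocks_multiply, hS', conjMat_mul_conjTranspose hS']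
  have hJK : fromBlocks S 0 0 (-(conjMat S)) = Jmat m * fromBlocks S 0 0 (conjMat S) := by
    simp [Jmat, fromBlocks_multiply]
  have hJJ : ∀ R : Matrix (Fin m ⊕ Fin m) (Fin n ⊕ Fin n) ℂ, Jmat m * (Jmat m * R) = R := by
    intro R
    rw [← Matrix.mul_assoc, Jmat_mul_Jmat, Matrix.one_mul]
  rw [hJK]
  generalize T * Jmat n * Tᴴ = Θ at hΘ ⊢
  generalize fromBlocks S 0 0 (conjMat S) = K at hKK ⊢
  have hKK' : ∀ R : Matrix (Fin m ⊕ Fin m) (Fin n ⊕ Fin n) ℂ,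
      K * (Jmat m * (Kᴴ * R)) = Jmat m * R := by
    intro R
    rw [← Matrix.mul_assoc (Jmat m), ← Matrix.mul_assoc K, ← Matrix.mul_assoc K, hKK]
  rw [Matrix.mul_assoc] at hKK
  intro s _ hP hQ
  refine transferFn_mul_mul_conjTranspose (Θ := Θ) ?_ ?_ ?_ ?_ ?_ hP hQ
  · simp only [conjTranspose_sub, conjTranspose_neg, conjTranspose_smul, conjTranspose_mul,
      conjTranspose_conjTranspose, conjTranspose_Jmat, hΘ, hM, Matrix.sub_mul, Matrix.mul_sub,
      Matrix.neg_mul, Matrix.mul_neg, Matrix.smul_mul, Matrix.mul_smul, Matrix.mul_assoc]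
    have h2 : star (1 / 2 : ℂ) = 1 / 2 := by simp
    have hI : star Complex.I = -Complex.I := Complex.conj_I
    rw [h2, hI]
    module
  · simp only [conjTranspose_neg, conjTranspose_mul, conjTranspose_conjTranspose,
      conjTranspose_Jmat, hΘ, Matrix.neg_mul, Matrix.mul_neg, neg_neg, Matrix.mul_assoc, hKK', hJJ]
  · simp only [Matrix.neg_mul, Matrix.mul_assoc, hKK, Jmat_mul_Jmat, Matrix.mul_one]
  · simp only [conjTranspose_neg, conjTranspose_mul, conjTranspose_conjTranspose,
      conjTranspose_Jmat, hΘ, Matrix.mul_neg, Matrix.mul_assoc, hKK', hJJ]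
  · rw [Matrix.mul_assoc, hKK]
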